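/- arXiv:2403.03546 — 2 statements merged into one kernel-verified Lean document; each statement's English description precedes it below -/
import Mathlib

section
/- Let (U,V) be a τ-cotorsion pair in C such that V is a torsion class. Then Defl(U ∩ V) = V. Consequently, the assignments T ↦ (^⊥₁(Defl(T)), Defl(T)) and (U,V) ↦ U ∩ V are mutually inverse bijections between the support τ-tilting subcategories of C and the τ-cotorsion pairs (U,V) of C with V a torsion class. -/
open CategoryTheory Category Limits Abelian

universe w v u

variable {C : Type u} [Category.{v} C] [Abelian C]
  [EnoughProjectives C] [EnoughInjectives C] [HasExt.{w} C]

/-- `f, g` form a short exact sequence `0 → A → B → X → 0`. -/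
def IsShortExactSeq {A B X : C} (f : A ⟶ B) (g : B ⟶ X) : Prop :=
  ∃ h : f ≫ g = 0, (ShortComplex.mk f g h).ShortExact

/-- `f, g` form a right exact sequence `A → B → X → 0`
(exact at `B` and at `X`, i.e. `g` is an epimorphism). -/
def IsRightExactSeq {A B X : C} (f : A ⟶ B) (g : B ⟶ X) : Prop :=
  ∃ h : f ≫ g = 0, (ShortComplex.mk f g h).Exact ∧ Epi g

/-- A (full, additive) subcategory, given by its class of objects: closed under
isomorphisms, direct summands and finite direct sums. -/
def IsSubcat (𝒯 : Set C) : Prop :=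
  (∀ ⦃X Y : C⦄, (X ≅ Y) → X ∈ 𝒯 → Y ∈ 𝒯) ∧
  (∀ ⦃X Y : C⦄, (X ⊞ Y) ∈ 𝒯 → X ∈ 𝒯 ∧ Y ∈ 𝒯) ∧
  (∀ ⦃X Y : C⦄, X ∈ 𝒯 → Y ∈ 𝒯 → (X ⊞ Y) ∈ 𝒯)

/-- `𝒯^⊥₁ = {X | Ext¹(T, X) = 0 for all T ∈ 𝒯}`. -/
def rightPerp1 (𝒯 : Set C) : Set C :=
  {X | ∀ T ∈ 𝒯, Subsingleton (Ext T X 1)}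

/-- `^⊥₁𝒱 = {X | Ext¹(X, V) = 0 for all V ∈ 𝒱}`. -/
def leftPerp1 (𝒱 : Set C) : Set C :=
  {X | ∀ V ∈ 𝒱, Subsingleton (Ext X V 1)}

/-- `Defl 𝒯`: objects admitting an epimorphism from an object of `𝒯`. -/
def Defl (𝒯 : Set C) : Set C :=
  {F | ∃ T ∈ 𝒯, ∃ g : T ⟶ F, Epi g}

/-- `𝒰` is a generator of `𝒱`: `𝒰 ⊆ 𝒱` and every `V ∈ 𝒱` fits in a short exact
sequence `0 → V' → U → V → 0` with `U ∈ 𝒰`, `V' ∈ 𝒱`. -/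
def IsGeneratorOf (𝒰 𝒱 : Set C) : Prop :=
  𝒰 ⊆ 𝒱 ∧ ∀ V ∈ 𝒱, ∃ V' ∈ 𝒱, ∃ U ∈ 𝒰, ∃ (f : V' ⟶ U) (g : U ⟶ V), IsShortExactSeq f g

/-- `f : P ⟶ T₀` is a left `𝒯`-approximation of `P`. -/
def IsLeftApprox (𝒯 : Set C) {P T₀ : C} (f : P ⟶ T₀) : Prop :=
  T₀ ∈ 𝒯 ∧ ∀ T ∈ 𝒯, ∀ φ : P ⟶ T, ∃ ψ : T₀ ⟶ T, f ≫ ψ = φ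

/-- `𝒯` is a support `τ`-tilting subcategory. -/
def IsSupportTauTilting (𝒯 : Set C) : Prop :=
  IsGeneratorOf 𝒯 (Defl 𝒯) ∧
  (∀ T ∈ 𝒯, ∀ D ∈ Defl 𝒯, Subsingleton (Ext T D 1)) ∧
  (∀ P : C, Projective P → ∃ T₀ ∈ 𝒯, ∃ T₁ ∈ 𝒯, ∃ (f : P ⟶ T₀) (g : T₀ ⟶ T₁),
    IsRightExactSeq f g ∧ IsLeftApprox 𝒯 f)

/-- `(𝒰, 𝒱)` is a `τ`-cotorsion pair. -/
def IsTauCotorsionPair (𝒰 𝒱 : Set C) : Prop :=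
  𝒰 = leftPerp1 𝒱 ∧
  ∀ P : C, Projective P → ∃ V₀ ∈ 𝒰 ∩ 𝒱, ∃ U₀ ∈ 𝒰, ∃ (f : P ⟶ V₀) (g : V₀ ⟶ U₀),
    IsRightExactSeq f g ∧ IsLeftApprox 𝒱 f

/-- `(𝒰, 𝒱)` is a cotorsion pair (both classes closed under direct summands). -/
def IsCotorsionPair (𝒰 𝒱 : Set C) : Prop :=
  (∀ ⦃X Y : C⦄, (X ⊞ Y) ∈ 𝒰 → X ∈ 𝒰 ∧ Y ∈ 𝒰) ∧
  (∀ ⦃X Y : C⦄, (X ⊞ Y) ∈ 𝒱 → X ∈ 𝒱 ∧ Y ∈ 𝒱) ∧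
  (∀ U ∈ 𝒰, ∀ V ∈ 𝒱, Subsingleton (Ext U V 1)) ∧
  (∀ X : C, ∃ V' ∈ 𝒱, ∃ U' ∈ 𝒰, ∃ (f : V' ⟶ U') (g : U' ⟶ X), IsShortExactSeq f g) ∧
  (∀ X : C, ∃ V' ∈ 𝒱, ∃ U' ∈ 𝒰, ∃ (f : X ⟶ V') (g : V' ⟶ U'), IsShortExactSeq f g)

/-- `𝒱` is a torsion class: closed under extensions and epimorphic images. -/
def IsTorsionClass (𝒱 : Set C) : Prop :=
  (∀ ⦃A B X : C⦄ (f : A ⟶ B) (g : B ⟶ X),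
    IsShortExactSeq f g → A ∈ 𝒱 → X ∈ 𝒱 → B ∈ 𝒱) ∧
  (∀ ⦃A B : C⦄ (g : A ⟶ B), Epi g → A ∈ 𝒱 → B ∈ 𝒱)

omit [EnoughProjectives C] [EnoughInjectives C] in
/-- Morphisms from `T` lift along an epimorphism whose kernel `A` satisfies `Ext¹(T, A) = 0`. -/
lemma IsShortExactSeq.exists_lift {A B X T : C} {f : A ⟶ B} {g : B ⟶ X}
    (hfg : IsShortExactSeq f g) (hT : Subsingleton (Ext.{w} T A 1)) (x : T ⟶ X) :
    ∃ l : T ⟶ B, l ≫ g = x := by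
  obtain ⟨_, hS⟩ := hfg
  obtain ⟨e, he⟩ := Ext.covariant_sequence_exact₃ T hS (Ext.mk₀ x) (zero_add 1)
    (hT.elim _ _)
  obtain ⟨l, rfl⟩ := (Ext.mk₀_bijective T B).2 e
  rw [Ext.mk₀_comp_mk₀] at he
  exact ⟨l, (Ext.mk₀_bijective T X).1 he⟩

omit [EnoughProjectives C] [EnoughInjectives C] in
lemma biprod_mem_leftPerp1 {𝒱 : Set C} {X Y : C} (hX : X ∈ leftPerp1.{w} 𝒱)
    (hY : Y ∈ leftPerp1.{w} 𝒱) : (X ⊞ Y) ∈ leftPerp1.{w} 𝒱 := by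
  intro V hV
  have := hX V hV
  have := hY V hV
  exact ⟨fun _ _ ↦ Ext.biprod_ext (Subsingleton.elim _ _) (Subsingleton.elim _ _)⟩

omit [EnoughProjectives C] [EnoughInjectives C] [HasExt.{w} C] in
lemma IsTorsionClass.biprod_mem {𝒱 : Set C} (hV : IsTorsionClass 𝒱) {X Y : C}
    (hX : X ∈ 𝒱) (hY : Y ∈ 𝒱) : (X ⊞ Y) ∈ 𝒱 :=
  hV.1 (biprod.inl : X ⟶ X ⊞ Y) biprod.snd
    ⟨biprod.inl_snd, (ShortComplex.Splitting.ofHasBinaryBiproduct X Y).shortExact⟩ hX hY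

omit [EnoughInjectives C] in
lemma IsTauCotorsionPair.exists_epi {𝒰 𝒱 : Set C} (h : IsTauCotorsionPair.{w} 𝒰 𝒱) {X : C}
    (hX : X ∈ 𝒱) : ∃ V₀ ∈ 𝒰 ∩ 𝒱, ∃ p : V₀ ⟶ X, Epi p := by
  obtain ⟨V₀, hV₀, _, _, f, _, _, _, happ⟩ := h.2 (Projective.over X) inferInstance
  obtain ⟨p, hp⟩ := happ X hX (Projective.π X)
  exact ⟨V₀, hV₀, p, epi_of_epi_fac hp⟩

omit [EnoughInjectives C] in
lemma IsTauCotorsionPair.defl_inter {𝒰 𝒱 : Set C} (h : IsTauCotorsionPair.{w} 𝒰 𝒱)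
    (hV : IsTorsionClass 𝒱) : Defl (𝒰 ∩ 𝒱) = 𝒱 := by
  ext X
  constructor
  · rintro ⟨T, hT, g, hg⟩
    exact hV.2 g hg hT.2
  · exact h.exists_epi

omit [EnoughProjectives C] [EnoughInjectives C] [HasExt.{w} C] in
/-- Let `Q ⟶ V ⟶ X` and `Q ⟶ W ⟶ W'` be exact, with `Q ⟶ V` factoring through `h : W ⟶ V` and
`k : W' ⟶ X` the induced map. Then `W ⟶ V ⊞ W' ⟶ X` is exact. -/
lemma exact_lift_desc {Q V X W W' : C} {i : Q ⟶ V} {p : V ⟶ X} (hip : i ≫ p = 0)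
    (hp : (ShortComplex.mk i p hip).Exact) {q : Q ⟶ W} {c : W ⟶ W'} (hqc : q ≫ c = 0)
    [Epi c] {h : W ⟶ V} (hq : q ≫ h = i) {k : W' ⟶ X} (hk : c ≫ k = h ≫ p)
    (w : biprod.lift h c ≫ biprod.desc p (-k) = 0) :
    (ShortComplex.mk (biprod.lift h c) (biprod.desc p (-k)) w).Exact := by
  rw [ShortComplex.exact_iff_exact_up_to_refinements]
  intro A y hy
  dsimp at y hy ⊢
  obtain ⟨A₁, π₁, _, b, hb⟩ := surjective_up_to_refinements_of_epi c (y ≫ biprod.snd)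
  have hy' : (y ≫ biprod.fst) ≫ p = (y ≫ biprod.snd) ≫ k := by
    simpa [biprod.desc_eq, ← sub_eq_add_neg, sub_eq_zero] using hy
  obtain ⟨A₂, π₂, _, a, ha⟩ := hp.exact_up_to_refinements (π₁ ≫ y ≫ biprod.fst - b ≫ h) (by
    dsimp
    rw [Preadditive.sub_comp, assoc, hy', assoc, assoc, ← hk, reassoc_of% hb, sub_self])
  dsimp at a ha
  refine ⟨A₂, π₂ ≫ π₁, inferInstance, π₂ ≫ b + a ≫ q, ?_⟩
  ext
  · simp [hq, ← ha]
  · simp [hqc, hb]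

omit [EnoughInjectives C] in
lemma IsTauCotorsionPair.isGeneratorOf {𝒰 𝒱 : Set C} (h : IsTauCotorsionPair.{w} 𝒰 𝒱)
    (hV : IsTorsionClass 𝒱) : IsGeneratorOf (𝒰 ∩ 𝒱) 𝒱 := by
  refine ⟨Set.inter_subset_right, fun X hX ↦ ?_⟩
  obtain ⟨V₀, hV₀, p, _⟩ := h.exists_epi hX
  let i : Projective.over (kernel p) ⟶ V₀ := Projective.π _ ≫ kernel.ι p
  have hip : i ≫ p = 0 := by simp [i]
  have hp : (ShortComplex.mk i p hip).Exact := by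
    rw [ShortComplex.exact_iff_epi_kernel_lift]
    have : kernel.lift p i hip = Projective.π (kernel p) := by
      simp [← cancel_mono (kernel.ι p), i]
    dsimp
    rw [this]
    infer_instance
  obtain ⟨W₀, hW₀, W₁, hW₁, q, c, ⟨hqc, hex, hc⟩, _, happ⟩ :=
    h.2 (Projective.over (kernel p)) inferInstance
  obtain ⟨l, hl⟩ := happ V₀ hV₀.2 i
  obtain ⟨k, hk⟩ : ∃ k : W₁ ⟶ X, c ≫ k = l ≫ p :=
    ⟨hex.desc (l ≫ p) (by dsimp; rw [reassoc_of% hl, hip]), hex.g_desc _ _⟩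
  have w : biprod.lift l c ≫ biprod.desc p (-k) = 0 := by simp [hk]
  have hE := exact_lift_desc hip hp hqc hl hk w
  have : Epi (biprod.desc p (-k)) := epi_of_epi_fac (biprod.inl_desc p (-k))
  have hU : (V₀ ⊞ W₁) ∈ 𝒰 := by
    rw [h.1] at hV₀ hW₁ ⊢
    exact biprod_mem_leftPerp1 hV₀.1 hW₁
  refine ⟨kernel (biprod.desc p (-k)), hV.2 (kernel.lift _ _ w) ?_ hW₀.2, V₀ ⊞ W₁,
    ⟨hU, hV.biprod_mem hV₀.2 (hV.2 c hc hW₀.2)⟩, kernel.ι _, biprod.desc p (-k),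
    kernel.condition _, ?_⟩
  · exact (ShortComplex.exact_iff_epi_kernel_lift _).1 hE
  · exact { exact := ShortComplex.exact_kernel _ }

omit [EnoughInjectives C] in
lemma IsTauCotorsionPair.isSupportTauTilting {𝒰 𝒱 : Set C} (h : IsTauCotorsionPair.{w} 𝒰 𝒱)
    (hV : IsTorsionClass 𝒱) : IsSupportTauTilting.{w} (𝒰 ∩ 𝒱) := by
  refine ⟨?_, ?_, fun P hP ↦ ?_⟩
  · rw [h.defl_inter hV]
    exact h.isGeneratorOf hV
  · rw [h.defl_inter hV, h.1]
    exact fun T hT ↦ hT.1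
  · obtain ⟨V₀, hV₀, U₀, hU₀, f, g, hfg, happ⟩ := h.2 P hP
    exact ⟨V₀, hV₀, U₀, ⟨hU₀, hV.2 g hfg.2.2 hV₀.2⟩, f, g, hfg, hV₀, fun T hT ↦ happ.2 T hT.2⟩

omit [Abelian C] [EnoughProjectives C] [EnoughInjectives C] [HasExt.{w} C] in
lemma subset_defl (𝒯 : Set C) : 𝒯 ⊆ Defl 𝒯 := fun T hT ↦ ⟨T, hT, 𝟙 T, inferInstance⟩

omit [EnoughProjectives C] [EnoughInjectives C] in
lemma IsSupportTauTilting.isTorsionClass_defl {𝒯 : Set C} (hT : IsSupportTauTilting.{w} 𝒯)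
    (h𝒯 : IsSubcat 𝒯) : IsTorsionClass (Defl 𝒯) := by
  constructor
  · rintro A B X f g hfg hA ⟨T, hTm, x, _⟩
    obtain ⟨l, hl⟩ := hfg.exists_lift (hT.2.1 T hTm A hA) x
    obtain ⟨T', hTm', a, _⟩ := hA
    obtain ⟨_, hS⟩ := hfg
    refine ⟨T ⊞ T', h𝒯.2.2 hTm hTm', biprod.desc l (a ≫ f),
      Preadditive.epi_of_cancel_zero _ fun {Z} k hk ↦ ?_⟩
    have hlk : l ≫ k = 0 := by simpa using biprod.inl ≫= hk
    have hfk : f ≫ k = 0 := by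
      rw [← cancel_epi a, comp_zero]
      simpa using biprod.inr ≫= hk
    have := hS.epi_g
    obtain ⟨m, rfl⟩ : ∃ m : X ⟶ Z, g ≫ m = k := ⟨hS.exact.desc k hfk, hS.exact.g_desc _ _⟩
    have hm : m = 0 := by
      rw [← cancel_epi x, ← hl, assoc, hlk, comp_zero]
    rw [hm, comp_zero]
  · rintro A B g _ ⟨T, hTm, p, _⟩
    exact ⟨T, hTm, p ≫ g, inferInstance⟩

omit [EnoughProjectives C] [EnoughInjectives C] in
lemma IsSupportTauTilting.isTauCotorsionPair {𝒯 : Set C} (hT : IsSupportTauTilting.{w} 𝒯) :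
    IsTauCotorsionPair.{w} (leftPerp1.{w} (Defl 𝒯)) (Defl 𝒯) := by
  refine ⟨rfl, fun P hP ↦ ?_⟩
  obtain ⟨T₀, hT₀, T₁, hT₁, f, g, hfg, happ⟩ := hT.2.2 P hP
  refine ⟨T₀, ⟨hT.2.1 T₀ hT₀, subset_defl 𝒯 hT₀⟩, T₁, hT.2.1 T₁ hT₁, f, g, hfg,
    subset_defl 𝒯 hT₀, ?_⟩
  rintro D ⟨T, hTm, p, _⟩ φ
  obtain ⟨ψ, hψ⟩ := happ.2 T hTm (Projective.factorThru φ p)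
  exact ⟨ψ ≫ p, by rw [reassoc_of% hψ, Projective.factorThru_comp]⟩

omit [EnoughProjectives C] [EnoughInjectives C] in
lemma IsSupportTauTilting.leftPerp1_inter_defl {𝒯 : Set C} (hT : IsSupportTauTilting.{w} 𝒯)
    (h𝒯 : IsSubcat 𝒯) : leftPerp1.{w} (Defl 𝒯) ∩ Defl 𝒯 = 𝒯 := by
  refine Set.Subset.antisymm ?_ fun T hTm ↦ ⟨hT.2.1 T hTm, subset_defl 𝒯 hTm⟩
  rintro X ⟨hX, hX'⟩
  obtain ⟨D, hD, T, hTm, f, g, hfg⟩ := hT.1.2 X hX'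
  obtain ⟨s, hs⟩ := hfg.exists_lift (hX D hD) (𝟙 X)
  obtain ⟨_, hS⟩ := hfg
  exact (h𝒯.2.1 (h𝒯.1
    (ShortComplex.Splitting.ofExactOfSection _ hS.exact s hs hS.mono_f).isoBinaryBiproduct hTm)).2

theorem stmt_13 (𝒰 𝒱 : Set C) (h : IsTauCotorsionPair 𝒰 𝒱) (hV : IsTorsionClass 𝒱) :
    Defl (𝒰 ∩ 𝒱) = 𝒱 ∧
    (∀ 𝒯 : Set C, IsSubcat 𝒯 → IsSupportTauTilting 𝒯 →
      IsTauCotorsionPair (leftPerp1 (Defl 𝒯)) (Defl 𝒯) ∧ IsTorsionClass (Defl 𝒯) ∧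
      leftPerp1 (Defl 𝒯) ∩ Defl 𝒯 = 𝒯) ∧
    (∀ 𝒰' 𝒱' : Set C, IsTauCotorsionPair 𝒰' 𝒱' → IsTorsionClass 𝒱' →
      IsSupportTauTilting (𝒰' ∩ 𝒱') ∧
      leftPerp1 (Defl (𝒰' ∩ 𝒱')) = 𝒰' ∧ Defl (𝒰' ∩ 𝒱') = 𝒱') := by
  refine ⟨h.defl_inter hV, fun 𝒯 h𝒯 hT ↦ ⟨hT.isTauCotorsionPair, hT.isTorsionClass_defl h𝒯,
    hT.leftPerp1_inter_defl h𝒯⟩, fun 𝒰' 𝒱' h' hV' ↦ ⟨h'.isSupportTauTilting hV', ?_,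
    h'.defl_inter hV'⟩⟩
  rw [h'.defl_inter hV', ← h'.1]
end

section
/- Let T be a tilting subcategory of C, i.e., pd(T) ≤ 1 and T is a generator of T^⊥₁. Then (^⊥₁(Defl(T)), Defl(T)) is a cotorsion pair in C, and Defl(T) is a torsion class. -/
open CategoryTheory Category Limits Abelian

universe w v u

variable {C : Type u} [Category.{v} C] [Abelian C]
  [EnoughProjectives C] [EnoughInjectives C] [HasExt.{w} C]

section ShortExactSequences

omit [EnoughProjectives C] [EnoughInjectives C] [HasExt.{w} C]

/-- The base change of a short exact sequence along a morphism into its last term. -/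
theorem IsShortExactSeq.of_isPullback {A B X Y P : C} {f : A ⟶ B} {g : B ⟶ X}
    (hfg : IsShortExactSeq f g) {h : Y ⟶ X} {p : P ⟶ B} {q : P ⟶ Y} (sq : IsPullback p q g h) :
    ∃ i : A ⟶ P, IsShortExactSeq i q := by
  obtain ⟨w, hS⟩ := hfg
  have : Mono f := hS.mono_f
  have : Epi g := hS.epi_g
  have : Epi q := by
    rw [← sq.isoPullback_hom_snd]
    infer_instance
  obtain ⟨i, hi, hi₀⟩ := sq.exists_lift f 0 (by simp [w])
  have : Mono i := mono_of_mono_fac hi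
  refine ⟨i, hi₀, ShortComplex.ShortExact.mk (ShortComplex.exact_of_f_is_kernel _
    (KernelFork.IsLimit.ofι' i hi₀ fun k hk => ⟨hS.exact.lift (k ≫ p) ?_, ?_⟩))⟩
  · dsimp
    rw [assoc, sq.w, reassoc_of% hk, zero_comp]
  · apply sq.hom_ext
    · rw [assoc, hi]
      exact hS.exact.lift_f _ _
    · rw [assoc, hi₀, comp_zero]
      exact hk.symm

/-- The cobase change of a short exact sequence along a morphism out of its first term. -/
theorem IsShortExactSeq.of_isPushout {A B X Y P : C} {f : A ⟶ B} {g : B ⟶ X}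
    (hfg : IsShortExactSeq f g) {h : A ⟶ Y} {i : B ⟶ P} {j : Y ⟶ P} (sq : IsPushout f h i j) :
    ∃ p : P ⟶ X, IsShortExactSeq j p := by
  obtain ⟨w, hS⟩ := hfg
  have : Mono f := hS.mono_f
  have : Epi g := hS.epi_g
  have : Mono j := by
    rw [← sq.inr_isoPushout_inv]
    infer_instance
  obtain ⟨p, hp, hp₀⟩ := sq.exists_desc g 0 (by simp [w])
  have : Epi p := epi_of_epi_fac hp
  refine ⟨p, hp₀, ShortComplex.ShortExact.mk (ShortComplex.exact_of_g_is_cokernel _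
    (CokernelCofork.IsColimit.ofπ' p hp₀ fun k hk => ⟨hS.exact.desc (i ≫ k) ?_, ?_⟩))⟩
  · dsimp
    rw [sq.w_assoc, hk, comp_zero]
  · apply sq.hom_ext
    · rw [reassoc_of% hp]
      exact hS.exact.g_desc _ _
    · rw [reassoc_of% hp₀, zero_comp]
      exact hk.symm

theorem isShortExactSeq_kernel {A B : C} (g : A ⟶ B) [Epi g] :
    IsShortExactSeq (kernel.ι g) g :=
  ⟨kernel.condition g, { exact := ShortComplex.exact_kernel g }⟩

theorem isShortExactSeq_cokernel {A B : C} (f : A ⟶ B) [Mono f] :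
    IsShortExactSeq f (cokernel.π f) :=
  ⟨cokernel.condition f, { exact := ShortComplex.exact_cokernel f }⟩

end ShortExactSequences

section Perpendicular

omit [EnoughProjectives C] [EnoughInjectives C]

theorem rightPerp1_of_extension (𝒯 : Set C) {A B X : C} {f : A ⟶ B} {g : B ⟶ X}
    (hfg : IsShortExactSeq f g) (hA : A ∈ rightPerp1 𝒯) (hX : X ∈ rightPerp1 𝒯) :
    B ∈ rightPerp1 𝒯 := by
  obtain ⟨w, hS⟩ := hfg
  intro T hT
  have := hA T hT
  have := hX T hT
  refine subsingleton_of_forall_eq 0 fun x => ?_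
  obtain ⟨y, rfl⟩ := Ext.covariant_sequence_exact₂ T hS x (Subsingleton.elim (α := Ext T X 1) _ _)
  rw [Subsingleton.elim (α := Ext T A 1) y 0]
  simp

theorem leftPerp1_of_extension (𝒱 : Set C) {A B X : C} {f : A ⟶ B} {g : B ⟶ X}
    (hfg : IsShortExactSeq f g) (hA : A ∈ leftPerp1 𝒱) (hX : X ∈ leftPerp1 𝒱) :
    B ∈ leftPerp1 𝒱 := by
  obtain ⟨w, hS⟩ := hfg
  intro V hV
  have := hA V hV
  have := hX V hV
  refine subsingleton_of_forall_eq 0 fun x => ?_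
  obtain ⟨y, rfl⟩ := Ext.contravariant_sequence_exact₂ hS V x
    (Subsingleton.elim (α := Ext A V 1) _ _)
  rw [Subsingleton.elim (α := Ext X V 1) y 0]
  simp

/-- `𝒯^⊥₁` is closed under quotients when `𝒯` has projective dimension at most one. -/
theorem rightPerp1_of_epi {𝒯 : Set C} (hpd : ∀ T ∈ 𝒯, ∀ X : C, Subsingleton (Ext T X 2))
    {A B : C} (g : A ⟶ B) [Epi g] (hA : A ∈ rightPerp1 𝒯) : B ∈ rightPerp1 𝒯 := by
  obtain ⟨w, hS⟩ := isShortExactSeq_kernel g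
  intro T hT
  have := hA T hT
  have := hpd T hT (kernel g)
  refine subsingleton_of_forall_eq 0 fun x => ?_
  obtain ⟨y, rfl⟩ := Ext.covariant_sequence_exact₃ T hS x (n₁ := 2) rfl
    (Subsingleton.elim (α := Ext T (kernel g) 2) _ _)
  rw [Subsingleton.elim (α := Ext T A 1) y 0]
  simp

theorem leftPerp1_of_retract (𝒱 : Set C) {X Z : C} (i : X ⟶ Z) (r : Z ⟶ X) (h : i ≫ r = 𝟙 X)
    (hZ : Z ∈ leftPerp1 𝒱) : X ∈ leftPerp1 𝒱 := by
  intro V hV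
  have := hZ V hV
  refine subsingleton_of_forall_eq 0 fun x => ?_
  have hx : (Ext.mk₀ i).comp ((Ext.mk₀ r).comp x (zero_add 1)) (zero_add 1) = x := by
    rw [Ext.mk₀_comp_mk₀_assoc, h, Ext.mk₀_id_comp]
  rw [← hx, Subsingleton.elim ((Ext.mk₀ r).comp x (zero_add 1)) 0, Ext.comp_zero]

theorem defl_eq_rightPerp1 {𝒯 : Set C} (hpd : ∀ T ∈ 𝒯, ∀ X : C, Subsingleton (Ext T X 2))
    (hgen : IsGeneratorOf 𝒯 (rightPerp1 𝒯)) : Defl 𝒯 = rightPerp1 𝒯 := by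
  ext F
  constructor
  · rintro ⟨T, hT, g, hg⟩
    exact rightPerp1_of_epi hpd g (hgen.1 hT)
  · intro hF
    obtain ⟨_, _, U, hU, _, g, _, hS⟩ := hgen.2 F hF
    exact ⟨U, hU, g, hS.epi_g⟩

end Perpendicular

omit [EnoughProjectives C] in
/-- Every object embeds in an object of `𝒯^⊥₁` with cokernel in `𝒯`. -/
theorem exists_embedding_rightPerp1 {𝒯 : Set C}
    (hpd : ∀ T ∈ 𝒯, ∀ X : C, Subsingleton (Ext T X 2))
    (hgen : IsGeneratorOf 𝒯 (rightPerp1 𝒯)) (X : C) :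
    ∃ V ∈ rightPerp1 𝒯, ∃ T ∈ 𝒯, ∃ (f : X ⟶ V) (g : V ⟶ T), IsShortExactSeq f g := by
  have hI : Injective.under X ∈ rightPerp1 𝒯 := fun T _ =>
    Ext.subsingleton_of_injective T (Injective.under X) 0
  obtain ⟨V, hV, T, hT, f, g, hfg⟩ :=
    hgen.2 _ (rightPerp1_of_epi hpd (cokernel.π (Injective.ι X)) hI)
  obtain ⟨i, hi⟩ :=
    (isShortExactSeq_cokernel (Injective.ι X)).of_isPullback (IsPullback.of_hasPullback _ g)
  obtain ⟨j, hj⟩ := hfg.of_isPullback (IsPullback.of_hasPullback (cokernel.π (Injective.ι X)) g).flip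
  exact ⟨_, rightPerp1_of_extension 𝒯 hj hV hI, T, hT, i, _, hi⟩

omit [EnoughInjectives C] in
/-- Salce's lemma: special preenvelopes yield special precovers, given enough projectives. -/
theorem exists_cover_of_embedding {𝒱 : Set C}
    (h : ∀ X : C, ∃ V' ∈ 𝒱, ∃ U' ∈ leftPerp1 𝒱, ∃ (f : X ⟶ V') (g : V' ⟶ U'),
      IsShortExactSeq f g) (X : C) :
    ∃ V' ∈ 𝒱, ∃ U' ∈ leftPerp1 𝒱, ∃ (f : V' ⟶ U') (g : U' ⟶ X), IsShortExactSeq f g := by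
  have hP : Projective.over X ∈ leftPerp1 𝒱 := fun V _ =>
    Ext.subsingleton_of_projective (Projective.over X) V 0
  obtain ⟨V, hV, U, hU, f, g, hfg⟩ := h (kernel (Projective.π X))
  obtain ⟨p, hp⟩ :=
    (isShortExactSeq_kernel (Projective.π X)).of_isPushout (IsPushout.of_hasPushout _ f)
  obtain ⟨q, hq⟩ := hfg.of_isPushout (IsPushout.of_hasPushout (kernel.ι (Projective.π X)) f).flip
  exact ⟨V, hV, _, leftPerp1_of_extension 𝒱 hq hP hU, _, p, hp⟩

theorem stmt_14 (𝒯 : Set C) (h𝒯 : IsSubcat 𝒯)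
    (hpd : ∀ T ∈ 𝒯, ∀ X : C, Subsingleton (Ext T X 2))
    (hgen : IsGeneratorOf 𝒯 (rightPerp1 𝒯)) :
    IsCotorsionPair (leftPerp1 (Defl 𝒯)) (Defl 𝒯) ∧ IsTorsionClass (Defl 𝒯) := by
  have hD := defl_eq_rightPerp1 hpd hgen
  have hemb : ∀ X : C, ∃ V' ∈ Defl 𝒯, ∃ U' ∈ leftPerp1 (Defl 𝒯),
      ∃ (f : X ⟶ V') (g : V' ⟶ U'), IsShortExactSeq f g := by
    intro X
    obtain ⟨V, hV, T, hT, f, g, hfg⟩ := exists_embedding_rightPerp1 hpd hgen X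
    rw [hD]
    exact ⟨V, hV, T, fun W hW => hW T hT, f, g, hfg⟩
  have hquot : ∀ ⦃A B : C⦄ (g : A ⟶ B), Epi g → A ∈ Defl 𝒯 → B ∈ Defl 𝒯 := by
    rintro A B g hg ⟨T, hT, p, hp⟩
    exact ⟨T, hT, p ≫ g, epi_comp p g⟩
  refine ⟨⟨fun X Y hXY => ?_, fun X Y hXY => ?_, fun U hU V hV => hU V hV,
    exists_cover_of_embedding hemb, hemb⟩, ?_, hquot⟩
  · exact ⟨leftPerp1_of_retract _ biprod.inl biprod.fst biprod.inl_fst hXY,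
      leftPerp1_of_retract _ biprod.inr biprod.snd biprod.inr_snd hXY⟩
  · exact ⟨hquot (biprod.fst : X ⊞ Y ⟶ X) inferInstance hXY,
      hquot (biprod.snd : X ⊞ Y ⟶ Y) inferInstance hXY⟩
  · intro A B X f g hfg hA hX
    rw [hD] at hA hX ⊢
    exact rightPerp1_of_extension 𝒯 hfg hA hX
end
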